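/- For every positive integer n, the circulant graph C_{6n+6}({1, 2n+1, 2n+3}) is edge-transitive. -/

import Mathlib

/-- A graph is edge-transitive if its automorphism group acts transitively on its edge set. -/
def EdgeTransitive {V : Type*} (G : SimpleGraph V) : Prop :=
  ∀ e₁ ∈ G.edgeSet, ∀ e₂ ∈ G.edgeSet, ∃ φ : G ≃g G, Sym2.map φ e₁ = e₂

/-- The circulant graph `C_n(L)` on vertex set `ZMod n`: distinct vertices `x`, `y` are
adjacent iff `x - y ≡ ±l (mod n)` for some `l ∈ L`. -/
def circulant (n : ℕ) (L : Finset ℤ) : SimpleGraph (ZMod n) :=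
  SimpleGraph.circulantGraph {x : ZMod n | ∃ l ∈ L, x = (l : ZMod n)}

/-- Adjacency in `C_{6n+6}(1, 2n+1, 2n+3)` depends only on residues modulo `2n+2`. -/
theorem circulant_adj_iff_cast (n : ℕ) (x y : ZMod (6*n+6)) :
    (circulant (6*n+6) ({1, 2*(n:ℤ)+1, 2*(n:ℤ)+3} : Finset ℤ)).Adj x y ↔
      ZMod.castHom (⟨3, by ring⟩ : 2*n+2 ∣ 6*n+6) (ZMod (2*n+2)) (x - y) = 1 ∨
      ZMod.castHom (⟨3, by ring⟩ : 2*n+2 ∣ 6*n+6) (ZMod (2*n+2)) (y - x) = 1 := by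
  set c := ZMod.castHom (⟨3, by ring⟩ : 2*n+2 ∣ 6*n+6) (ZMod (2*n+2))
  have hN : (6 * n + 6 : ZMod (6*n+6)) = 0 := by
    exact_mod_cast ZMod.natCast_self (6*n+6)
  have hM : (2 * n + 2 : ZMod (2*n+2)) = 0 := by
    exact_mod_cast ZMod.natCast_self (2*n+2)
  have one_ne : (1 : ZMod (2*n+2)) ≠ 0 := by
    have : Fact (1 < 2*n+2) := ⟨by omega⟩
    exact one_ne_zero
  have key : ∀ d : ZMod (6*n+6), c d = 1 →
      d = 1 ∨ d = 2*n+3 ∨ -d = 2*n+1 := by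
    intro d hd
    obtain ⟨v, rfl⟩ := ZMod.intCast_surjective d
    rw [map_intCast] at hd
    have h : ((v - 1 : ℤ) : ZMod (2*n+2)) = 0 := by push_cast; rw [hd]; ring
    rw [ZMod.intCast_zmod_eq_zero_iff_dvd] at h
    obtain ⟨k, hk⟩ := h
    push_cast at hk
    obtain ⟨q, hq⟩ : ∃ q, k = 3 * q + k % 3 := ⟨k / 3, by omega⟩
    have hv : (v : ZMod (6*n+6)) = 1 + (2*n+2) * ((k % 3 : ℤ) : ZMod (6*n+6)) := by
      have e : v = 1 + (2*n+2) * (k % 3) + (6*n+6) * q := by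
        linear_combination hk + (2*n+2) * hq
      have e' := congrArg (Int.cast : ℤ → ZMod (6*n+6)) e
      push_cast at e'
      rw [e', hN]
      ring
    rw [hv]
    have h3 : k % 3 = 0 ∨ k % 3 = 1 ∨ k % 3 = 2 := by omega
    rcases h3 with h | h | h <;> rw [h] <;> push_cast
    · left; ring
    · right; left; ring
    · right; right; linear_combination -hN
  simp only [circulant, SimpleGraph.circulantGraph, SimpleGraph.fromRel_adj, Set.mem_ofPred_eq,
    Finset.mem_insert, Finset.mem_singleton, exists_eq_or_imp, exists_eq_left]
  push_cast
  constructor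
  · have fwd : ∀ d : ZMod (6*n+6), d = 1 ∨ d = 2*n+1 ∨ d = 2*n+3 → c d = 1 ∨ c (-d) = 1 := by
      rintro d (rfl | rfl | rfl)
      · left; simp
      · right; simp only [map_neg, map_add, map_mul, map_natCast, map_ofNat, map_one]
        linear_combination -hM
      · left; simp only [map_add, map_mul, map_natCast, map_ofNat]
        linear_combination hM
    rintro ⟨-, h | h⟩
    · exact neg_sub x y ▸ fwd _ h
    · exact (neg_sub y x ▸ fwd _ h).symm
  · intro h
    refine ⟨?_, ?_⟩
    · rintro rfl
      rw [sub_self, map_zero] at h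
      exact one_ne (h.elim Eq.symm Eq.symm)
    · rcases h with h | h <;>
      · have := key _ h
        rw [neg_sub] at this
        tauto

/-- Swapping two vertices with the same neighbours is an automorphism. -/
def SimpleGraph.swapTwins {V : Type*} [DecidableEq V] (G : SimpleGraph V) (a b : V)
    (h : ∀ z, G.Adj a z ↔ G.Adj b z) : G ≃g G where
  toEquiv := Equiv.swap a b
  map_rel_iff' := by
    have h' : ∀ z w, G.Adj (Equiv.swap a b z) w ↔ G.Adj z w := by
      intro z w
      rw [Equiv.swap_apply_def]
      split_ifs with h1 h2
      · rw [h1, h]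
      · rw [h2, h]
      · rfl
    intro z w
    rw [h', G.adj_comm, h', G.adj_comm]

/-- Translation by `t` as an automorphism of a circulant graph. -/
def circulantTranslate (N : ℕ) (L : Finset ℤ) (t : ZMod N) : circulant N L ≃g circulant N L where
  toEquiv := Equiv.addRight t
  map_rel_iff' := by
    intro x y
    simp [circulant, SimpleGraph.circulantGraph]

/-- This circulant graph is edge-transitive for every positive integer `n`. -/
theorem circulant_class_edgeTransitive (n : ℕ) (hn : 0 < n) :
    EdgeTransitive (circulant (6*n+6) ({1, 2*(n:ℤ)+1, 2*(n:ℤ)+3} : Finset ℤ)) := by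
  set G := circulant (6*n+6) ({1, 2*(n:ℤ)+1, 2*(n:ℤ)+3} : Finset ℤ)
  have hadj : ∀ x y, G.Adj x y ↔ _ := circulant_adj_iff_cast n
  set c := ZMod.castHom (⟨3, by ring⟩ : 2*n+2 ∣ 6*n+6) (ZMod (2*n+2))
  have orient : ∀ e ∈ G.edgeSet, ∃ x y, e = s(x, y) ∧ c (x - y) = 1 := by
    intro e
    induction e using Sym2.ind with
    | _ x y =>
      intro h
      rcases (hadj x y).1 h with h | h
      · exact ⟨x, y, rfl, h⟩
      · exact ⟨y, x, Sym2.eq_swap, h⟩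
  intro e₁ he₁ e₂ he₂
  obtain ⟨x, y, rfl, hxy⟩ := orient e₁ he₁
  obtain ⟨u, v, rfl, huv⟩ := orient e₂ he₂
  have twins : ∀ z, G.Adj (y + (u - x)) z ↔ G.Adj v z := by
    intro z
    have e : c (y + (u - x)) = c v := by
      simp only [map_add, map_sub] at hxy huv ⊢
      linear_combination huv - hxy
    rw [hadj, hadj, map_sub, map_sub, map_sub, map_sub, e]
  have hu : u ≠ y + (u - x) := fun h =>
    G.ne_of_adj he₁ (by linear_combination h)
  refine ⟨(circulantTranslate _ _ (u - x)).trans (G.swapTwins _ _ twins), ?_⟩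
  have h1 : Equiv.swap (y + (u - x)) v (x + (u - x)) = u := by
    rw [add_sub_cancel, Equiv.swap_apply_of_ne_of_ne hu (G.ne_of_adj he₂)]
  have h2 : Equiv.swap (y + (u - x)) v (y + (u - x)) = v := Equiv.swap_apply_left _ _
  exact congrArg₂ (fun a b => s(a, b)) h1 h2
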